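/- Fix positive reals L₁, L₂, L₃ and M₁ ≥ 0, and let α_e ∈ (0, π/2) satisfy R₁² + M₁² > L₂² and R₂² > L₃², where R₁ = L₁ / tan α_e, R₂ = √(R₁² + M₁² − L₂²), and R₃ = √(R₂² − L₃²). Define the circular equilibrium angles β₃ₑ = arctan(L₃/R₃) and β₂ₑ = arctan(M₁/R₁) + arctan(L₂/R₂). Then the right-hand side of the β₃-equation of the general 2-trailer model vanishes at this configuration: cos β₂ₑ · ((1/L₂)(tan β₂ₑ − (M₁/L₁) tan α_e) − (sin β₃ₑ/L₃)(1 + (M₁/L₁) tan β₂ₑ tan α_e)) = 0. -/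

import Mathlib

open Real

/-- In a right triangle with hypotenuse `r` and opposite leg `x`, the sine of the angle is `x / r`. -/
theorem sin_arctan_div_sqrt_sq_sub_sq {x r : ℝ} (hr : 0 < r) (h : x ^ 2 < r ^ 2) :
    sin (arctan (x / √(r ^ 2 - x ^ 2))) = x / r := by
  have hs : 0 < √(r ^ 2 - x ^ 2) := Real.sqrt_pos.2 (sub_pos.2 h)
  have hsq : √(r ^ 2 - x ^ 2) ^ 2 = r ^ 2 - x ^ 2 := Real.sq_sqrt (sub_pos.2 h).le
  have hsqrt : √(1 + (x / √(r ^ 2 - x ^ 2)) ^ 2) = r / √(r ^ 2 - x ^ 2) := by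
    rw [Real.sqrt_eq_iff_mul_self_eq (by positivity) (by positivity)]
    field_simp
    rw [hsq]
    ring
  rw [sin_arctan, hsqrt]
  field_simp

theorem sin_arctan_eq_mul_cos_arctan (x : ℝ) : sin (arctan x) = x * cos (arctan x) := by
  rw [sin_arctan, cos_arctan]
  ring

/-- The relation `tan (a + b) - tan a = tan b * (1 + tan a * tan (a + b))`, cleared of the
denominator `cos (a + b)`. -/
theorem sin_sub_mul_cos_arctan_add_arctan (m n : ℝ) :
    sin (arctan m + arctan n) - m * cos (arctan m + arctan n) =
      n * (cos (arctan m + arctan n) + m * sin (arctan m + arctan n)) := by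
  rw [sin_add, cos_add, sin_arctan_eq_mul_cos_arctan m, sin_arctan_eq_mul_cos_arctan n]
  ring

/-- At the circular equilibrium configuration of the general 2-trailer system
determined by a constant steering angle `α_e`, the right-hand side of the
`β₃`-equation vanishes. -/
theorem general_two_trailer_beta3_equilibrium
    (L₁ L₂ L₃ M₁ αe : ℝ) (hL₁ : 0 < L₁) (hL₂ : 0 < L₂) (hL₃ : 0 < L₃)
    (hM₁ : 0 ≤ M₁) (hαe : αe ∈ Set.Ioo 0 (π / 2))
    (R₁ R₂ R₃ : ℝ)
    (hR₁ : R₁ = L₁ / tan αe)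
    (hR₂ : R₂ = Real.sqrt (R₁ ^ 2 + M₁ ^ 2 - L₂ ^ 2))
    (hR₃ : R₃ = Real.sqrt (R₂ ^ 2 - L₃ ^ 2))
    (h1 : L₂ ^ 2 < R₁ ^ 2 + M₁ ^ 2) (h2 : L₃ ^ 2 < R₂ ^ 2)
    (β₃e β₂e : ℝ)
    (hβ₃e : β₃e = arctan (L₃ / R₃))
    (hβ₂e : β₂e = arctan (M₁ / R₁) + arctan (L₂ / R₂)) :
    cos β₂e * (1 / L₂ * (tan β₂e - M₁ / L₁ * tan αe) -
      sin β₃e / L₃ * (1 + M₁ / L₁ * tan β₂e * tan αe)) = 0 := by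
  have hR₂pos : 0 < R₂ := hR₂ ▸ Real.sqrt_pos.2 (sub_pos.2 h1)
  have hm : M₁ / L₁ * tan αe = M₁ / R₁ := by
    rw [hR₁, div_div_eq_mul_div]
    ring
  have hsin : sin β₃e = L₃ / R₂ := by
    rw [hβ₃e, hR₃, sin_arctan_div_sqrt_sq_sub_sq hR₂pos h2]
  by_cases hc : cos β₂e = 0
  · rw [hc, zero_mul]
  have hT : cos β₂e * tan β₂e = sin β₂e := by rw [mul_comm, tan_mul_cos hc]
  have hkey := sin_sub_mul_cos_arctan_add_arctan (M₁ / R₁) (L₂ / R₂)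
  rw [← hβ₂e] at hkey
  calc
    _ = 1 / L₂ * (cos β₂e * tan β₂e - M₁ / L₁ * tan αe * cos β₂e) -
        sin β₃e / L₃ * (cos β₂e + M₁ / L₁ * tan αe * (cos β₂e * tan β₂e)) := by ring
    _ = 0 := by
      rw [hT, hm, hsin, hkey]
      field_simp
      ring
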